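/- Let rot be the one-step rotation relation on List α: rot l l' iff (l = [] and l' = []) or there exist x, xs with l = x :: xs and l' = xs ++ [x]; and let ~cyc = EqvGen rot be its equivalence closure (cyclic-list equivalence). For all relations S : α → β → Prop and T : β → γ → Prop whose composition Comp S T is nonempty: if List.Forall₂ S xs us, us ~cyc vs, and List.Forall₂ T vs zs, then there exist xs' and zs' with xs ~cyc xs', List.Forall₂ (Comp S T) xs' zs', and zs' ~cyc zs. (Subdistributivity of the relator for cyclic lists.) -/

import Mathlib

/-- Composition of two relations. -/
def Comp {α β γ : Type*} (S : α → β → Prop) (T : β → γ → Prop) (a : α) (c : γ) : Prop :=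
  ∃ b, S a b ∧ T b c

/-- One-step rotation of a list. -/
def Rot {α : Type*} (l l' : List α) : Prop :=
  (l = [] ∧ l' = []) ∨ ∃ (x : α) (xs : List α), l = x :: xs ∧ l' = xs ++ [x]

/-- A rotation of the right-hand list of `List.Forall₂ S` lifts to the left-hand list. -/
theorem Rot.exists_forall₂ {α β : Type*} {S : α → β → Prop} {us vs : List β}
    (h : Rot us vs) {xs : List α} (hxs : List.Forall₂ S xs us) :
    ∃ xs', Rot xs xs' ∧ List.Forall₂ S xs' vs := by
  rcases h with ⟨rfl, rfl⟩ | ⟨u, us, rfl, rfl⟩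
  · exact ⟨[], Or.inl ⟨List.forall₂_nil_right_iff.mp hxs, rfl⟩, .nil⟩
  · obtain ⟨x, xs, hx, htl, rfl⟩ := List.forall₂_cons_right_iff.mp hxs
    exact ⟨xs ++ [x], Or.inr ⟨x, xs, rfl, rfl⟩, List.rel_append htl (.cons hx .nil)⟩

/-- An inverse rotation of the right-hand list of `List.Forall₂ S` lifts to the left-hand list. -/
theorem Rot.exists_forall₂_symm {α β : Type*} {S : α → β → Prop} {us vs : List β}
    (h : Rot us vs) {xs : List α} (hxs : List.Forall₂ S xs vs) :
    ∃ xs', Rot xs' xs ∧ List.Forall₂ S xs' us := by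
  rcases h with ⟨rfl, rfl⟩ | ⟨u, us, rfl, rfl⟩
  · exact ⟨[], Or.inl ⟨rfl, List.forall₂_nil_right_iff.mp hxs⟩, .nil⟩
  · rcases xs.eq_nil_or_concat' with rfl | ⟨ys, x, rfl⟩
    · simp at hxs
    · have hrev := List.rel_reverse hxs
      simp only [List.reverse_append, List.reverse_singleton, List.singleton_append,
        List.forall₂_cons, List.forall₂_reverse_iff] at hrev
      exact ⟨x :: ys, Or.inr ⟨x, ys, rfl, rfl⟩, .cons hrev.1 hrev.2⟩

/-- Cyclic equivalence of the right-hand list of `List.Forall₂ S` lifts to the left-hand list. -/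
theorem eqvGen_rot_exists_forall₂ {α β : Type*} {S : α → β → Prop} {us vs : List β}
    (h : Relation.EqvGen Rot us vs) :
    (∀ xs : List α, List.Forall₂ S xs us →
      ∃ xs', Relation.EqvGen Rot xs xs' ∧ List.Forall₂ S xs' vs) ∧
    (∀ xs : List α, List.Forall₂ S xs vs →
      ∃ xs', Relation.EqvGen Rot xs xs' ∧ List.Forall₂ S xs' us) := by
  induction h with
  | rel us vs h =>
    refine ⟨fun xs hxs => ?_, fun xs hxs => ?_⟩
    · obtain ⟨xs', hr, hxs'⟩ := h.exists_forall₂ hxs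
      exact ⟨xs', .rel _ _ hr, hxs'⟩
    · obtain ⟨xs', hr, hxs'⟩ := h.exists_forall₂_symm hxs
      exact ⟨xs', .symm _ _ (.rel _ _ hr), hxs'⟩
  | refl us => exact ⟨fun xs hxs => ⟨xs, .refl _, hxs⟩, fun xs hxs => ⟨xs, .refl _, hxs⟩⟩
  | symm us vs _ ih => exact ih.symm
  | trans us vs ws _ _ ih₁ ih₂ =>
    refine ⟨fun xs hxs => ?_, fun xs hxs => ?_⟩
    · obtain ⟨ys, hxy, hys⟩ := ih₁.1 xs hxs
      obtain ⟨zs, hyz, hzs⟩ := ih₂.1 ys hys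
      exact ⟨zs, .trans _ _ _ hxy hyz, hzs⟩
    · obtain ⟨ys, hxy, hys⟩ := ih₂.2 xs hxs
      obtain ⟨zs, hyz, hzs⟩ := ih₁.2 ys hys
      exact ⟨zs, .trans _ _ _ hxy hyz, hzs⟩

/-- `List.Forall₂` is compatible with composition of relations. -/
theorem List.Forall₂.comp {α β γ : Type*} {S : α → β → Prop} {T : β → γ → Prop}
    {xs : List α} {ys : List β} {zs : List γ}
    (hS : List.Forall₂ S xs ys) (hT : List.Forall₂ T ys zs) :
    List.Forall₂ (Comp S T) xs zs := by
  induction hS generalizing zs with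
  | nil => cases hT; exact .nil
  | cons h _ ih =>
    cases hT with
    | cons h' hT => exact .cons ⟨_, h, h'⟩ (ih hT)

/-- Subdistributivity of the relator for cyclic lists. -/
theorem cyclic_subdistributivity {α β γ : Type*}
    (S : α → β → Prop) (T : β → γ → Prop)
    (hne : ∃ a c, Comp S T a c)
    (xs : List α) (us vs : List β) (zs : List γ)
    (hxu : List.Forall₂ S xs us)
    (huv : Relation.EqvGen Rot us vs)
    (hvz : List.Forall₂ T vs zs) :
    ∃ (xs' : List α) (zs' : List γ),
      Relation.EqvGen Rot xs xs' ∧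
      List.Forall₂ (Comp S T) xs' zs' ∧
      Relation.EqvGen Rot zs' zs := by
  obtain ⟨xs', hxx', hxs'⟩ := (eqvGen_rot_exists_forall₂ huv).1 xs hxu
  exact ⟨xs', zs, hxx', hxs'.comp hvz, .refl _⟩
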